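/- Let A and B be connected graded unital 𝕜-algebras and τ: B⊗A → A⊗B a graded twisting map. Then τ has the unique extension property if and only if A⊗_τB is τ-quadratic, i.e. the ideal I_τ of the free product A*B generated by all τ-relations b⊗a − τ(b⊗a) is generated by its homogeneous elements of degree 2. -/

import Mathlib

open TensorProduct

noncomputable section

namespace TTP

variable (𝕜 : Type) [Field 𝕜]

/-- The image of `p ⊗ q` inside `M ⊗[𝕜] N`, for submodules `p ⊆ M`, `q ⊆ N`. -/
def subTmul {M N : Type} [AddCommGroup M] [Module 𝕜 M] [AddCommGroup N] [Module 𝕜 N]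
    (p : Submodule 𝕜 M) (q : Submodule 𝕜 N) : Submodule 𝕜 (M ⊗[𝕜] N) :=
  LinearMap.range (TensorProduct.map p.subtype q.subtype)

/-- The Künneth grading on a tensor product of graded vector spaces. -/
def kunneth {M N : Type} [AddCommGroup M] [Module 𝕜 M] [AddCommGroup N] [Module 𝕜 N]
    (𝒜 : ℕ → Submodule 𝕜 M) (ℬ : ℕ → Submodule 𝕜 N) (n : ℕ) : Submodule 𝕜 (M ⊗[𝕜] N) :=
  ⨆ (pq : ℕ × ℕ) (_ : pq.1 + pq.2 = n), subTmul 𝕜 (𝒜 pq.1) (ℬ pq.2)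

/-- The positive part `X₊ = ⊕_{i>0} X_i` of a graded vector space. -/
def plusPart {M : Type} [AddCommGroup M] [Module 𝕜 M] (𝒜 : ℕ → Submodule 𝕜 M) :
    Submodule 𝕜 M :=
  ⨆ (i : ℕ) (_ : 0 < i), 𝒜 i

/-- The grading concentrating `𝒜 1` in degree `1` (and `⊥` elsewhere). -/
def degOne {M : Type} [AddCommGroup M] [Module 𝕜 M] (𝒜 : ℕ → Submodule 𝕜 M) :
    ℕ → Submodule 𝕜 M :=
  fun n => if n = 1 then 𝒜 1 else ⊥

variable (A B : Type) [Ring A] [Algebra 𝕜 A] [Ring B] [Algebra 𝕜 B]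

/-- `τ ∘ (μ_B ⊗ μ_A)` on `(B ⊗ B) ⊗ (A ⊗ A)`. -/
def twistLHS (τ : B ⊗[𝕜] A →ₗ[𝕜] A ⊗[𝕜] B) :
    (B ⊗[𝕜] B) ⊗[𝕜] (A ⊗[𝕜] A) →ₗ[𝕜] A ⊗[𝕜] B :=
  τ ∘ₗ TensorProduct.map (LinearMap.mul' 𝕜 B) (LinearMap.mul' 𝕜 A)

/-- `(μ_A ⊗ μ_B) ∘ (1_A ⊗ τ ⊗ 1_B) ∘ (τ ⊗ τ) ∘ (1_B ⊗ τ ⊗ 1_A)` on `(B ⊗ B) ⊗ (A ⊗ A)`. -/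
def twistRHS (τ : B ⊗[𝕜] A →ₗ[𝕜] A ⊗[𝕜] B) :
    (B ⊗[𝕜] B) ⊗[𝕜] (A ⊗[𝕜] A) →ₗ[𝕜] A ⊗[𝕜] B :=
  TensorProduct.map (LinearMap.mul' 𝕜 A) (LinearMap.mul' 𝕜 B)
    ∘ₗ (TensorProduct.assoc 𝕜 A A (B ⊗[𝕜] B)).symm.toLinearMap
    ∘ₗ LinearMap.lTensor A (TensorProduct.assoc 𝕜 A B B).toLinearMap
    ∘ₗ LinearMap.lTensor A (LinearMap.rTensor B τ)
    ∘ₗ LinearMap.lTensor A (TensorProduct.assoc 𝕜 B A B).symm.toLinearMap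
    ∘ₗ (TensorProduct.assoc 𝕜 A B (A ⊗[𝕜] B)).toLinearMap
    ∘ₗ TensorProduct.map τ τ
    ∘ₗ (TensorProduct.assoc 𝕜 B A (B ⊗[𝕜] A)).symm.toLinearMap
    ∘ₗ LinearMap.lTensor B (TensorProduct.assoc 𝕜 A B A).toLinearMap
    ∘ₗ LinearMap.lTensor B (LinearMap.rTensor A τ)
    ∘ₗ LinearMap.lTensor B (TensorProduct.assoc 𝕜 B A A).symm.toLinearMap
    ∘ₗ (TensorProduct.assoc 𝕜 B B (A ⊗[𝕜] A)).toLinearMap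

/-- `τ : B ⊗ A → A ⊗ B` is an (algebra) twisting map: it satisfies the unital twisting
conditions and `τ(μ_B ⊗ μ_A) = (μ_A ⊗ μ_B)(1_A ⊗ τ ⊗ 1_B)(τ ⊗ τ)(1_B ⊗ τ ⊗ 1_A)`. -/
def IsTwisting (τ : B ⊗[𝕜] A →ₗ[𝕜] A ⊗[𝕜] B) : Prop :=
  (∀ a : A, τ ((1 : B) ⊗ₜ[𝕜] a) = a ⊗ₜ[𝕜] (1 : B)) ∧
  (∀ b : B, τ (b ⊗ₜ[𝕜] (1 : A)) = (1 : A) ⊗ₜ[𝕜] b) ∧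
  twistLHS 𝕜 A B τ = twistRHS 𝕜 A B τ

/-- `τ` preserves the Künneth grading. -/
def IsGradedMapBA (𝒜 : ℕ → Submodule 𝕜 A) (ℬ : ℕ → Submodule 𝕜 B)
    (τ : B ⊗[𝕜] A →ₗ[𝕜] A ⊗[𝕜] B) : Prop :=
  ∀ n, Submodule.map τ (kunneth 𝕜 ℬ 𝒜 n) ≤ kunneth 𝕜 𝒜 ℬ n

/-- `τ` is a graded twisting map. -/
def IsGradedTwisting (𝒜 : ℕ → Submodule 𝕜 A) (ℬ : ℕ → Submodule 𝕜 B)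
    (τ : B ⊗[𝕜] A →ₗ[𝕜] A ⊗[𝕜] B) : Prop :=
  IsTwisting 𝕜 A B τ ∧ IsGradedMapBA 𝕜 A B 𝒜 ℬ τ

/-- A graded linear map `τ` is graded twisting to degree `n`:  it satisfies the unital
conditions and the twisting identity in all (Künneth) degrees `≤ n`. -/
def TwistingToDeg (𝒜 : ℕ → Submodule 𝕜 A) (ℬ : ℕ → Submodule 𝕜 B)
    (τ : B ⊗[𝕜] A →ₗ[𝕜] A ⊗[𝕜] B) (n : ℕ) : Prop :=
  IsGradedMapBA 𝕜 A B 𝒜 ℬ τ ∧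
  (∀ j ≤ n, ∀ a ∈ 𝒜 j, τ ((1 : B) ⊗ₜ[𝕜] a) = a ⊗ₜ[𝕜] (1 : B)) ∧
  (∀ j ≤ n, ∀ b ∈ ℬ j, τ (b ⊗ₜ[𝕜] (1 : A)) = (1 : A) ⊗ₜ[𝕜] b) ∧
  (∀ j ≤ n, ∀ x ∈ kunneth 𝕜 (kunneth 𝕜 ℬ ℬ) (kunneth 𝕜 𝒜 𝒜) j,
    twistLHS 𝕜 A B τ x = twistRHS 𝕜 A B τ x)

/-- The unique extension property of a graded twisting map:  for every `n ≥ 3`, any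
linear map `τ'` that is graded twisting to degree `n` and agrees with `τ` in all degrees
`< n` also agrees with `τ` in degree `n`. -/
def UEP (𝒜 : ℕ → Submodule 𝕜 A) (ℬ : ℕ → Submodule 𝕜 B)
    (τ : B ⊗[𝕜] A →ₗ[𝕜] A ⊗[𝕜] B) : Prop :=
  ∀ n, 3 ≤ n → ∀ τ' : B ⊗[𝕜] A →ₗ[𝕜] A ⊗[𝕜] B,
    TwistingToDeg 𝕜 A B 𝒜 ℬ τ' n →
    (∀ i < n, ∀ x ∈ kunneth 𝕜 ℬ 𝒜 i, τ' x = τ x) →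
    ∀ x ∈ kunneth 𝕜 ℬ 𝒜 n, τ' x = τ x

/-- The multiplication `μ_τ = (μ_A ⊗ μ_B)(1_A ⊗ τ ⊗ 1_B)` on `A ⊗ B`. -/
def mulTau (τ : B ⊗[𝕜] A →ₗ[𝕜] A ⊗[𝕜] B) :
    (A ⊗[𝕜] B) ⊗[𝕜] (A ⊗[𝕜] B) →ₗ[𝕜] A ⊗[𝕜] B :=
  TensorProduct.map (LinearMap.mul' 𝕜 A) (LinearMap.mul' 𝕜 B)
    ∘ₗ (TensorProduct.assoc 𝕜 A A (B ⊗[𝕜] B)).symm.toLinearMap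
    ∘ₗ LinearMap.lTensor A (TensorProduct.assoc 𝕜 A B B).toLinearMap
    ∘ₗ LinearMap.lTensor A (LinearMap.rTensor B τ)
    ∘ₗ LinearMap.lTensor A (TensorProduct.assoc 𝕜 B A B).symm.toLinearMap
    ∘ₗ (TensorProduct.assoc 𝕜 A B (A ⊗[𝕜] B)).toLinearMap

/-- `(C, ψ)` realizes the twisted tensor product algebra `A ⊗_τ B`:  `ψ` is a linear
isomorphism carrying the multiplication `μ_τ` and its unit to those of `C`. -/
def Realizes (τ : B ⊗[𝕜] A →ₗ[𝕜] A ⊗[𝕜] B) (C : Type) [Ring C] [Algebra 𝕜 C]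
    (ψ : A ⊗[𝕜] B →ₗ[𝕜] C) : Prop :=
  Function.Bijective ψ ∧ ψ ((1 : A) ⊗ₜ[𝕜] (1 : B)) = 1 ∧
  ∀ x y : A ⊗[𝕜] B, ψ (mulTau 𝕜 A B τ (x ⊗ₜ[𝕜] y)) = ψ x * ψ y

/-- The two-sided ideal generated by a subset, as a `𝕜`-submodule. -/
def idealSpan (C : Type) [Ring C] [Algebra 𝕜 C] (s : Set C) : Submodule 𝕜 C :=
  Submodule.span 𝕜 {x | ∃ c d r, r ∈ s ∧ x = c * r * d}

/-- Weight grading of the tensor algebra. -/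
def tensorWeight (V : Type) [AddCommGroup V] [Module 𝕜 V] (n : ℕ) :
    Submodule 𝕜 (TensorAlgebra 𝕜 V) :=
  LinearMap.range (TensorAlgebra.ι 𝕜 (M := V)) ^ n

instance (V : Type) [AddCommGroup V] [Module 𝕜 V] : GradedAlgebra (tensorWeight 𝕜 V) :=
  inferInstanceAs (GradedAlgebra
    ((LinearMap.range (TensorAlgebra.ι 𝕜 : V →ₗ[𝕜] TensorAlgebra 𝕜 V) ^ ·) : ℕ → Submodule 𝕜 _))

/-- The canonical map `T(C₁) → C` for a graded algebra `C`. -/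
def canMap (C : Type) [Ring C] [Algebra 𝕜 C] (𝒞 : ℕ → Submodule 𝕜 C) :
    TensorAlgebra 𝕜 ↥(𝒞 1) →ₐ[𝕜] C :=
  TensorAlgebra.lift 𝕜 (𝒞 1).subtype

/-- `C` (with grading `𝒞`) is a quadratic algebra: the canonical map `T(C₁) → C` is
surjective and its kernel is generated, as a two-sided ideal, by its degree 2 part. -/
def IsQuadraticAlg (C : Type) [Ring C] [Algebra 𝕜 C] (𝒞 : ℕ → Submodule 𝕜 C) : Prop :=
  Function.Surjective (canMap 𝕜 C 𝒞) ∧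
  LinearMap.ker (canMap 𝕜 C 𝒞).toLinearMap =
    idealSpan 𝕜 (TensorAlgebra 𝕜 ↥(𝒞 1))
      ((LinearMap.ker (canMap 𝕜 C 𝒞).toLinearMap ⊓ tensorWeight 𝕜 ↥(𝒞 1) 2 : Submodule 𝕜 _) : Set _)

/-- The left ideal generated by the positive part of a graded algebra. -/
def augIdeal (C : Type) [Ring C] [Algebra 𝕜 C] (𝒞 : ℕ → Submodule 𝕜 C) : Submodule C C :=
  Submodule.span C {x : C | ∃ i, 0 < i ∧ x ∈ 𝒞 i}

/-- The degree `n` component of the graded free module on generators `σ` in degree `i`. -/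
def freeGrade (C : Type) [Ring C] [Algebra 𝕜 C] (𝒞 : ℕ → Submodule 𝕜 C)
    (i : ℕ) (σ : Type) (n : ℕ) : Submodule 𝕜 (σ →₀ C) :=
  ⨅ (j : σ), Submodule.comap (Finsupp.lapply j : (σ →₀ C) →ₗ[𝕜] C)
    (if i ≤ n then 𝒞 (n - i) else ⊥)

/-- `C` (with grading `𝒞`) is a Koszul algebra: the trivial module `𝕜 = C/C₊` admits a
resolution by graded free modules with the `i`-th term generated in degree `i`. -/
def IsKoszul (C : Type) [Ring C] [Algebra 𝕜 C] (𝒞 : ℕ → Submodule 𝕜 C) : Prop :=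
  ∃ (σ : ℕ → Type) (d : ∀ i : ℕ, ((σ (i + 1)) →₀ C) →ₗ[C] ((σ i) →₀ C))
    (ε : ((σ 0) →₀ C) →ₗ[C] (C ⧸ augIdeal 𝕜 C 𝒞)),
    Function.Surjective ε ∧
    LinearMap.ker ε = LinearMap.range (d 0) ∧
    (∀ i, LinearMap.ker (d i) = LinearMap.range (d (i + 1))) ∧
    (∀ i n, ∀ x ∈ freeGrade 𝕜 C 𝒞 (i + 1) (σ (i + 1)) n, d i x ∈ freeGrade 𝕜 C 𝒞 i (σ i) n) ∧
    (∀ n, 0 < n → ∀ x ∈ freeGrade 𝕜 C 𝒞 0 (σ 0) n, ε x = 0)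

/-- `(P, ιA, ιB)` is a free product (coproduct) of `A` and `B`. -/
def IsFreeProduct (P : Type) [Ring P] [Algebra 𝕜 P] (ιA : A →ₐ[𝕜] P) (ιB : B →ₐ[𝕜] P) :
    Prop :=
  ∀ (C : Type) [Ring C] [Algebra 𝕜 C], ∀ (f : A →ₐ[𝕜] C) (g : B →ₐ[𝕜] C),
    ∃! h : P →ₐ[𝕜] C, h.comp ιA = f ∧ h.comp ιB = g

/-- The linear map `A ⊗ B → P`, `a ⊗ b ↦ ιA(a) · ιB(b)`. -/
def mulMapP (P : Type) [Ring P] [Algebra 𝕜 P] (ιA : A →ₐ[𝕜] P) (ιB : B →ₐ[𝕜] P) :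
    A ⊗[𝕜] B →ₗ[𝕜] P :=
  TensorProduct.lift (LinearMap.mk₂ 𝕜 (fun a b => ιA a * ιB b)
    (fun a a' b => by simp [map_add, add_mul])
    (fun c a b => by simp [map_smul, smul_mul_assoc])
    (fun a b b' => by simp [map_add, mul_add])
    (fun c a b => by simp [map_smul, mul_smul_comm]))

/-- The set of `τ`-relations `b ⊗ a - τ(b ⊗ a)` of total degree at most `n`,
inside the free product `P`. -/
def relSetLe (P : Type) [Ring P] [Algebra 𝕜 P] (ιA : A →ₐ[𝕜] P) (ιB : B →ₐ[𝕜] P)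
    (𝒜 : ℕ → Submodule 𝕜 A) (ℬ : ℕ → Submodule 𝕜 B)
    (τ : B ⊗[𝕜] A →ₗ[𝕜] A ⊗[𝕜] B) (n : ℕ) : Set P :=
  {x | ∃ i j a b, i + j ≤ n ∧ a ∈ 𝒜 i ∧ b ∈ ℬ j ∧
    x = ιB b * ιA a - mulMapP 𝕜 A B P ιA ιB (τ (b ⊗ₜ[𝕜] a))}

/-- The set of all `τ`-relations `b ⊗ a - τ(b ⊗ a)` inside the free product `P`. -/
def relSetAll (P : Type) [Ring P] [Algebra 𝕜 P] (ιA : A →ₐ[𝕜] P) (ιB : B →ₐ[𝕜] P)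
    (τ : B ⊗[𝕜] A →ₗ[𝕜] A ⊗[𝕜] B) : Set P :=
  {x | ∃ a b, x = ιB b * ιA a - mulMapP 𝕜 A B P ιA ιB (τ (b ⊗ₜ[𝕜] a))}

/-- The (Künneth) grading on the free product `P` of the graded algebras `A` and `B`. -/
def freeProdGrade (P : Type) [Ring P] [Algebra 𝕜 P] (ιA : A →ₐ[𝕜] P) (ιB : B →ₐ[𝕜] P)
    (𝒜 : ℕ → Submodule 𝕜 A) (ℬ : ℕ → Submodule 𝕜 B) (n : ℕ) : Submodule 𝕜 P :=
  ⨆ (l : List ℕ) (_ : l.sum = n),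
    ((l.map (fun i => Submodule.map ιA.toLinearMap (𝒜 i) ⊔ Submodule.map ιB.toLinearMap (ℬ i))).foldr
      (· * ·) 1)

end TTP

namespace TTP

section Twisting

variable {𝕜 : Type} [Field 𝕜]

section Grading

variable {M N V : Type} [AddCommGroup M] [Module 𝕜 M] [AddCommGroup N] [Module 𝕜 N]
  [AddCommGroup V] [Module 𝕜 V] {𝒜 : ℕ → Submodule 𝕜 M} {ℬ : ℕ → Submodule 𝕜 N}

lemma tmul_mem_kunneth {i j n : ℕ} (h : i + j = n) {a : M} {b : N} (ha : a ∈ 𝒜 i) (hb : b ∈ ℬ j) :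
    a ⊗ₜ[𝕜] b ∈ kunneth 𝕜 𝒜 ℬ n :=
  Submodule.mem_iSup_of_mem (i, j) <| Submodule.mem_iSup_of_mem h
    ⟨(⟨a, ha⟩ : 𝒜 i) ⊗ₜ[𝕜] (⟨b, hb⟩ : ℬ j), by simp⟩

lemma kunneth_le {n : ℕ} {S : Submodule 𝕜 (M ⊗[𝕜] N)}
    (h : ∀ i j, i + j = n → ∀ a ∈ 𝒜 i, ∀ b ∈ ℬ j, a ⊗ₜ[𝕜] b ∈ S) : kunneth 𝕜 𝒜 ℬ n ≤ S := by
  refine iSup₂_le fun pq hpq ↦ ?_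
  rintro _ ⟨y, rfl⟩
  induction y using TensorProduct.induction_on with
  | zero => simp
  | tmul a b => simpa using h _ _ hpq a a.2 b b.2
  | add x y hx hy => simpa using S.add_mem hx hy

lemma eqOn_kunneth {n : ℕ} {f g : M ⊗[𝕜] N →ₗ[𝕜] V}
    (h : ∀ i j, i + j = n → ∀ a ∈ 𝒜 i, ∀ b ∈ ℬ j, f (a ⊗ₜ[𝕜] b) = g (a ⊗ₜ[𝕜] b))
    {x : M ⊗[𝕜] N} (hx : x ∈ kunneth 𝕜 𝒜 ℬ n) : f x = g x :=
  kunneth_le (S := LinearMap.eqLocus f g) h hx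

lemma map_mem_of_mem_kunneth {n : ℕ} (f : M ⊗[𝕜] N →ₗ[𝕜] V) (S : Submodule 𝕜 V)
    (h : ∀ i j, i + j = n → ∀ a ∈ 𝒜 i, ∀ b ∈ ℬ j, f (a ⊗ₜ[𝕜] b) ∈ S)
    {x : M ⊗[𝕜] N} (hx : x ∈ kunneth 𝕜 𝒜 ℬ n) : f x ∈ S :=
  kunneth_le (S := S.comap f) h hx

/-- The part of a tensor product in degrees greater than `n`. -/
def kunnethGT (𝒜 : ℕ → Submodule 𝕜 M) (ℬ : ℕ → Submodule 𝕜 N) (n : ℕ) :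
    Submodule 𝕜 (M ⊗[𝕜] N) :=
  ⨆ (m : ℕ) (_ : n < m), kunneth 𝕜 𝒜 ℬ m

lemma mem_kunnethGT {n m : ℕ} (h : n < m) {x : M ⊗[𝕜] N} (hx : x ∈ kunneth 𝕜 𝒜 ℬ m) :
    x ∈ kunnethGT 𝒜 ℬ n :=
  Submodule.mem_iSup_of_mem m (Submodule.mem_iSup_of_mem h hx)

lemma kunnethGT_le_comap {n : ℕ} {f : M ⊗[𝕜] N →ₗ[𝕜] V} {S : Submodule 𝕜 V}
    (h : ∀ m, n < m → ∀ x ∈ kunneth 𝕜 𝒜 ℬ m, f x ∈ S) : kunnethGT 𝒜 ℬ n ≤ S.comap f :=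
  iSup₂_le fun m hm x hx ↦ h m hm x hx

section Decomposition

variable [DirectSum.Decomposition 𝒜] [DirectSum.Decomposition ℬ]

lemma homogeneous_ext {f g : M →ₗ[𝕜] V} (h : ∀ i, ∀ a ∈ 𝒜 i, f a = g a) : f = g := by
  ext a
  induction a using DirectSum.Decomposition.inductionOn 𝒜 with
  | zero => simp
  | homogeneous m => exact h _ m m.2
  | add x y hx hy => simp [hx, hy]

lemma homogeneous_mem (f : M →ₗ[𝕜] V) (S : Submodule 𝕜 V) (h : ∀ i, ∀ a ∈ 𝒜 i, f a ∈ S) (a : M) :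
    f a ∈ S := by
  induction a using DirectSum.Decomposition.inductionOn 𝒜 with
  | zero => simp
  | homogeneous m => exact h _ m m.2
  | add x y hx hy => simpa using S.add_mem hx hy

lemma homogeneous_tmul_mem (f : M ⊗[𝕜] N →ₗ[𝕜] V) (S : Submodule 𝕜 V)
    (h : ∀ i j, ∀ a ∈ 𝒜 i, ∀ b ∈ ℬ j, f (a ⊗ₜ[𝕜] b) ∈ S) (x : M ⊗[𝕜] N) : f x ∈ S := by
  induction x using TensorProduct.induction_on with
  | zero => simp
  | tmul a b =>
    refine homogeneous_mem (𝒜 := 𝒜) (f ∘ₗ (TensorProduct.mk 𝕜 M N).flip b) S (fun i a ha ↦ ?_) a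
    exact homogeneous_mem (𝒜 := ℬ) (f ∘ₗ TensorProduct.mk 𝕜 M N a) S (fun j b hb ↦ h i j a ha b hb) b
  | add x y hx hy => simpa using S.add_mem hx hy

/-- The projection onto the component of degree `i` of a graded vector space. -/
def gradeProj (𝒜 : ℕ → Submodule 𝕜 M) [DirectSum.Decomposition 𝒜] (i : ℕ) : M →ₗ[𝕜] M :=
  (𝒜 i).subtype ∘ₗ DirectSum.component 𝕜 ℕ (fun i ↦ 𝒜 i) i ∘ₗ
    (DirectSum.decomposeLinearEquiv 𝒜).toLinearMap

lemma gradeProj_of_mem {i j : ℕ} {a : M} (ha : a ∈ 𝒜 i) :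
    gradeProj 𝒜 j a = if i = j then a else 0 := by
  change (DirectSum.decompose 𝒜 a j : M) = _
  split_ifs with h
  · subst h; exact DirectSum.decompose_of_mem_same 𝒜 ha
  · exact DirectSum.decompose_of_mem_ne 𝒜 ha h

/-- The projection onto the component of degree `n` of a tensor product. -/
def kunnethProj (𝒜 : ℕ → Submodule 𝕜 M) (ℬ : ℕ → Submodule 𝕜 N) [DirectSum.Decomposition 𝒜]
    [DirectSum.Decomposition ℬ] (n : ℕ) : M ⊗[𝕜] N →ₗ[𝕜] M ⊗[𝕜] N :=
  ∑ i ∈ Finset.range (n + 1), TensorProduct.map (gradeProj 𝒜 i) (gradeProj ℬ (n - i))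

lemma kunnethProj_of_mem {n m : ℕ} {x : M ⊗[𝕜] N} (hx : x ∈ kunneth 𝕜 𝒜 ℬ m) :
    kunnethProj 𝒜 ℬ n x = if m = n then x else 0 := by
  have : kunnethProj 𝒜 ℬ n x = (if m = n then LinearMap.id else 0 : M ⊗[𝕜] N →ₗ[𝕜] M ⊗[𝕜] N) x := by
    refine eqOn_kunneth (fun i j hij a ha b hb ↦ ?_) hx
    simp only [kunnethProj, LinearMap.sum_apply, TensorProduct.map_tmul, gradeProj_of_mem ha,
      gradeProj_of_mem hb]
    rw [Finset.sum_congr rfl (g := fun k ↦ if i = k then (if m = n then a ⊗ₜ[𝕜] b else 0) else 0)]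
    · rw [Finset.sum_ite_eq]
      split_ifs with h₁ h₂ <;> simp_all
      omega
    · intro k hk
      rw [Finset.mem_range] at hk
      split_ifs <;> first | omega | simp
  rw [this]
  split_ifs <;> simp

lemma eq_zero_of_mem_kunnethGT {n : ℕ} {x : M ⊗[𝕜] N} (hx : x ∈ kunneth 𝕜 𝒜 ℬ n)
    (hx' : x ∈ kunnethGT 𝒜 ℬ n) : x = 0 := by
  have h : kunnethGT 𝒜 ℬ n ≤ Submodule.comap (kunnethProj 𝒜 ℬ n) ⊥ :=
    kunnethGT_le_comap fun m hm y hy ↦ by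
      rw [kunnethProj_of_mem hy, if_neg (by omega)]; exact Submodule.zero_mem _
  have := h hx'
  rwa [Submodule.mem_comap, kunnethProj_of_mem hx, if_pos rfl, Submodule.mem_bot] at this

end Decomposition

end Grading

section Actions

variable {A B : Type} [Ring A] [Algebra 𝕜 A] [Ring B] [Algebra 𝕜 B]

/-- Left multiplication by elements of `A` on `A ⊗ B`. -/
def tensorMulLeft : A →ₗ[𝕜] A ⊗[𝕜] B →ₗ[𝕜] A ⊗[𝕜] B :=
  LinearMap.rTensorHom B ∘ₗ LinearMap.mul 𝕜 A

/-- Right multiplication by elements of `B` on `A ⊗ B`. -/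
def tensorMulRight : B →ₗ[𝕜] A ⊗[𝕜] B →ₗ[𝕜] A ⊗[𝕜] B :=
  LinearMap.lTensorHom A ∘ₗ (LinearMap.mul 𝕜 B).flip

@[simp]
lemma tensorMulLeft_tmul (a a' : A) (b : B) :
    tensorMulLeft a (a' ⊗ₜ[𝕜] b) = (a * a') ⊗ₜ[𝕜] b := rfl

@[simp]
lemma tensorMulRight_tmul (a : A) (b b' : B) :
    tensorMulRight b (a ⊗ₜ[𝕜] b') = a ⊗ₜ[𝕜] (b' * b) := rfl

/-- The map `b ⊗ (a ⊗ b') ↦ τ(b ⊗ a) b'`, linear in `b` and in `a ⊗ b'`. -/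
def leftAct (τ : B ⊗[𝕜] A →ₗ[𝕜] A ⊗[𝕜] B) : B →ₗ[𝕜] A ⊗[𝕜] B →ₗ[𝕜] A ⊗[𝕜] B :=
  TensorProduct.curry <| TensorProduct.lift (tensorMulRight.flip ∘ₗ τ) ∘ₗ
    (TensorProduct.assoc 𝕜 B A B).symm.toLinearMap

/-- The map `a ⊗ (a' ⊗ b) ↦ a' τ(b ⊗ a)`, linear in `a` and in `a' ⊗ b`. -/
def rightAct (τ : B ⊗[𝕜] A →ₗ[𝕜] A ⊗[𝕜] B) : A →ₗ[𝕜] A ⊗[𝕜] B →ₗ[𝕜] A ⊗[𝕜] B :=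
  (TensorProduct.curry <| TensorProduct.lift (tensorMulLeft.compl₂ τ) ∘ₗ
    (TensorProduct.assoc 𝕜 A B A).toLinearMap).flip

variable (τ : B ⊗[𝕜] A →ₗ[𝕜] A ⊗[𝕜] B)

@[simp]
lemma leftAct_tmul (b b' : B) (a : A) :
    leftAct τ b (a ⊗ₜ[𝕜] b') = tensorMulRight b' (τ (b ⊗ₜ[𝕜] a)) := rfl

@[simp]
lemma rightAct_tmul (a a' : A) (b : B) :
    rightAct τ a (a' ⊗ₜ[𝕜] b) = tensorMulLeft a' (τ (b ⊗ₜ[𝕜] a)) := rfl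

/-- The multiplication of `A ⊗ B` twisted by `τ`, as a bilinear map. -/
def twistMul : A ⊗[𝕜] B →ₗ[𝕜] A ⊗[𝕜] B →ₗ[𝕜] A ⊗[𝕜] B :=
  TensorProduct.lift ((LinearMap.lcomp 𝕜 _ (leftAct τ)) ∘ₗ (LinearMap.llcomp 𝕜 _ _ _) ∘ₗ tensorMulLeft)

@[simp]
lemma twistMul_tmul (a : A) (b : B) (x : A ⊗[𝕜] B) :
    twistMul τ (a ⊗ₜ[𝕜] b) x = tensorMulLeft a (leftAct τ b x) := rfl

lemma mulTau_tmul (x y : A ⊗[𝕜] B) : mulTau 𝕜 A B τ (x ⊗ₜ[𝕜] y) = twistMul τ x y := by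
  induction x using TensorProduct.induction_on with
  | zero => simp
  | add x x' hx hx' => simp only [TensorProduct.add_tmul, map_add, LinearMap.add_apply, hx, hx']
  | tmul a b =>
    induction y using TensorProduct.induction_on with
    | zero => simp
    | add y y' hy hy' => simp only [TensorProduct.tmul_add, map_add, hy, hy']
    | tmul a' b' =>
      simp only [mulTau, LinearMap.comp_apply, LinearEquiv.coe_coe, TensorProduct.assoc_tmul,
        LinearMap.lTensor_tmul, TensorProduct.assoc_symm_tmul, LinearMap.rTensor_tmul,
        twistMul_tmul, leftAct_tmul]
      generalize τ (b ⊗ₜ[𝕜] a') = z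
      induction z using TensorProduct.induction_on with
      | zero => simp
      | add z z' hz hz' => simp only [TensorProduct.add_tmul, TensorProduct.tmul_add, map_add, hz, hz']
      | tmul p q => simp

/-- The map `a ⊗ b ↦ τ(b₁ ⊗ a) τ(b ⊗ a₂)`, where the product is the twisted one. -/
def twistSandwich (b₁ : B) (a₂ : A) : A ⊗[𝕜] B →ₗ[𝕜] A ⊗[𝕜] B :=
  mulTau 𝕜 A B τ ∘ₗ TensorProduct.map (τ ∘ₗ TensorProduct.mk 𝕜 B A b₁)
    (τ ∘ₗ (TensorProduct.mk 𝕜 B A).flip a₂)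

lemma twistSandwich_tmul (b₁ b : B) (a a₂ : A) : twistSandwich τ b₁ a₂ (a ⊗ₜ[𝕜] b) =
    twistMul τ (τ (b₁ ⊗ₜ[𝕜] a)) (τ (b ⊗ₜ[𝕜] a₂)) := by
  simp [twistSandwich, mulTau_tmul]

lemma twistRHS_tmul (b₁ b₂ : B) (a₁ a₂ : A) :
    twistRHS 𝕜 A B τ ((b₁ ⊗ₜ[𝕜] b₂) ⊗ₜ[𝕜] (a₁ ⊗ₜ[𝕜] a₂)) =
      twistSandwich τ b₁ a₂ (τ (b₂ ⊗ₜ[𝕜] a₁)) := by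
  change mulTau 𝕜 A B τ _ = _
  simp only [twistSandwich, LinearMap.comp_apply, LinearEquiv.coe_coe, TensorProduct.assoc_tmul,
    LinearMap.lTensor_tmul, TensorProduct.assoc_symm_tmul, LinearMap.rTensor_tmul]
  congr 1
  generalize τ (b₂ ⊗ₜ[𝕜] a₁) = z
  induction z using TensorProduct.induction_on with
  | zero => simp
  | add z z' hz hz' => simp only [TensorProduct.add_tmul, TensorProduct.tmul_add, map_add, hz, hz']
  | tmul p q => simp

lemma tensorMulLeft_one : tensorMulLeft (1 : A) = (LinearMap.id : A ⊗[𝕜] B →ₗ[𝕜] A ⊗[𝕜] B) := by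
  ext; simp

lemma tensorMulRight_one : tensorMulRight (1 : B) = (LinearMap.id : A ⊗[𝕜] B →ₗ[𝕜] A ⊗[𝕜] B) := by
  ext; simp

lemma tensorMulLeft_mul (a a' : A) (x : A ⊗[𝕜] B) :
    tensorMulLeft (a * a') x = tensorMulLeft a (tensorMulLeft a' x) := by
  induction x using TensorProduct.induction_on with
  | zero => simp
  | add x x' hx hx' => simp [hx, hx']
  | tmul a b => simp [mul_assoc]

lemma tensorMulRight_mul (b b' : B) (x : A ⊗[𝕜] B) :
    tensorMulRight (b * b') x = tensorMulRight b' (tensorMulRight b x) := by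
  induction x using TensorProduct.induction_on with
  | zero => simp
  | add x x' hx hx' => simp [hx, hx']
  | tmul a b => simp [mul_assoc]

lemma tensorMulLeft_tensorMulRight (a : A) (b : B) (x : A ⊗[𝕜] B) :
    tensorMulLeft a (tensorMulRight b x) = tensorMulRight b (tensorMulLeft a x) := by
  induction x using TensorProduct.induction_on with
  | zero => simp
  | add x x' hx hx' => simp [hx, hx']
  | tmul a b => simp

lemma leftAct_tensorMulRight (b b' : B) (x : A ⊗[𝕜] B) :
    leftAct τ b (tensorMulRight b' x) = tensorMulRight b' (leftAct τ b x) := by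
  induction x using TensorProduct.induction_on with
  | zero => simp
  | add x x' hx hx' => simp [hx, hx']
  | tmul a c => simp [tensorMulRight_mul]

end Actions

section Graded

variable {A B : Type} [Ring A] [Algebra 𝕜 A] [Ring B] [Algebra 𝕜 B]
  {𝒜 : ℕ → Submodule 𝕜 A} {ℬ : ℕ → Submodule 𝕜 B} [GradedAlgebra 𝒜] [GradedAlgebra ℬ]
  {τ : B ⊗[𝕜] A →ₗ[𝕜] A ⊗[𝕜] B} {n : ℕ}

lemma tensorMulLeft_mem_kunneth {i m k : ℕ} (h : i + m = k) {a : A} (ha : a ∈ 𝒜 i)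
    {x : A ⊗[𝕜] B} (hx : x ∈ kunneth 𝕜 𝒜 ℬ m) : tensorMulLeft a x ∈ kunneth 𝕜 𝒜 ℬ k :=
  map_mem_of_mem_kunneth _ _ (fun p q _ _ hp _ hq ↦
    tmul_mem_kunneth (i := i + p) (j := q) (by omega) (SetLike.mul_mem_graded ha hp) hq) hx

lemma tensorMulRight_mem_kunneth {i m k : ℕ} (h : m + i = k) {b : B} (hb : b ∈ ℬ i)
    {x : A ⊗[𝕜] B} (hx : x ∈ kunneth 𝕜 𝒜 ℬ m) : tensorMulRight b x ∈ kunneth 𝕜 𝒜 ℬ k :=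
  map_mem_of_mem_kunneth _ _ (fun p q _ _ hp _ hq ↦
    tmul_mem_kunneth (i := p) (j := q + i) (by omega) hp (SetLike.mul_mem_graded hq hb)) hx

lemma IsGradedMapBA.tmul_mem (hτ : IsGradedMapBA 𝕜 A B 𝒜 ℬ τ) {i j k : ℕ} (h : i + j = k) {b : B}
    (hb : b ∈ ℬ i) {a : A} (ha : a ∈ 𝒜 j) : τ (b ⊗ₜ[𝕜] a) ∈ kunneth 𝕜 𝒜 ℬ k :=
  hτ k ⟨_, tmul_mem_kunneth h hb ha, rfl⟩

lemma IsGradedMapBA.leftAct_mem (hτ : IsGradedMapBA 𝕜 A B 𝒜 ℬ τ) {i m k : ℕ} (h : i + m = k) {b : B}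
    (hb : b ∈ ℬ i) {x : A ⊗[𝕜] B} (hx : x ∈ kunneth 𝕜 𝒜 ℬ m) :
    leftAct τ b x ∈ kunneth 𝕜 𝒜 ℬ k :=
  map_mem_of_mem_kunneth _ _ (fun p q _ _ hp _ hq ↦ by
    simpa using tensorMulRight_mem_kunneth (by omega) hq (hτ.tmul_mem (k := i + p) rfl hb hp)) hx

lemma IsGradedMapBA.twistMul_mem (hτ : IsGradedMapBA 𝕜 A B 𝒜 ℬ τ) {l m k : ℕ} (h : l + m = k)
    {x y : A ⊗[𝕜] B} (hx : x ∈ kunneth 𝕜 𝒜 ℬ l) (hy : y ∈ kunneth 𝕜 𝒜 ℬ m) :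
    twistMul τ x y ∈ kunneth 𝕜 𝒜 ℬ k :=
  map_mem_of_mem_kunneth ((twistMul τ).flip y) _ (fun p q _ a hp b hq ↦ by
    simpa using tensorMulLeft_mem_kunneth (by omega) hp (hτ.leftAct_mem (k := q + m) rfl hq hy)) hx

/-- Compatibility of `τ` with the multiplication of `B` in degrees at most `n`. -/
def LeftTwistingToDeg (𝒜 : ℕ → Submodule 𝕜 A) (ℬ : ℕ → Submodule 𝕜 B)
    (τ : B ⊗[𝕜] A →ₗ[𝕜] A ⊗[𝕜] B) (n : ℕ) : Prop :=
  ∀ i j k, i + j + k ≤ n → ∀ b ∈ ℬ i, ∀ b' ∈ ℬ j, ∀ a ∈ 𝒜 k,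
    τ ((b * b') ⊗ₜ[𝕜] a) = leftAct τ b (τ (b' ⊗ₜ[𝕜] a))

/-- Compatibility of `τ` with the multiplication of `A` in degrees at most `n`. -/
def RightTwistingToDeg (𝒜 : ℕ → Submodule 𝕜 A) (ℬ : ℕ → Submodule 𝕜 B)
    (τ : B ⊗[𝕜] A →ₗ[𝕜] A ⊗[𝕜] B) (n : ℕ) : Prop :=
  ∀ i j k, i + j + k ≤ n → ∀ b ∈ ℬ i, ∀ a ∈ 𝒜 j, ∀ a' ∈ 𝒜 k,
    τ (b ⊗ₜ[𝕜] (a * a')) = rightAct τ a' (τ (b ⊗ₜ[𝕜] a))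

lemma TwistingToDeg.tmul_mul (h : TwistingToDeg 𝕜 A B 𝒜 ℬ τ n) {i j k l : ℕ}
    (hn : i + j + (k + l) ≤ n) {b b' : B} (hb : b ∈ ℬ i) (hb' : b' ∈ ℬ j) {a a' : A}
    (ha : a ∈ 𝒜 k) (ha' : a' ∈ 𝒜 l) :
    τ ((b * b') ⊗ₜ[𝕜] (a * a')) = twistSandwich τ b a' (τ (b' ⊗ₜ[𝕜] a)) := by
  rw [← twistRHS_tmul, ← h.2.2.2 _ hn _ (tmul_mem_kunneth rfl (tmul_mem_kunneth rfl hb hb')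
    (tmul_mem_kunneth rfl ha ha'))]
  simp [twistLHS]

lemma TwistingToDeg.twistMul_one_tmul (h : TwistingToDeg 𝕜 A B 𝒜 ℬ τ n) {m : ℕ} (hm : m ≤ n)
    {x : A ⊗[𝕜] B} (hx : x ∈ kunneth 𝕜 𝒜 ℬ m) (b : B) :
    twistMul τ x (1 ⊗ₜ[𝕜] b) = tensorMulRight b x := by
  refine eqOn_kunneth (f := (twistMul τ).flip (1 ⊗ₜ[𝕜] b)) (fun p q hpq a ha c hc ↦ ?_) hx
  simp [h.2.2.1 q (by omega) c hc]

lemma TwistingToDeg.left (h : TwistingToDeg 𝕜 A B 𝒜 ℬ τ n) : LeftTwistingToDeg 𝒜 ℬ τ n := by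
  intro i j k hn b hb b' hb' a ha
  have := h.tmul_mul (l := 0) (by omega) hb hb' ha (SetLike.one_mem_graded 𝒜)
  rw [mul_one] at this
  rw [this]
  refine eqOn_kunneth (fun p q hpq a ha c hc ↦ ?_) (h.1.tmul_mem rfl hb' ha)
  rw [twistSandwich_tmul, h.2.2.1 q (by omega) c hc, leftAct_tmul,
    h.twistMul_one_tmul (m := i + p) (by omega) (h.1.tmul_mem rfl hb ha)]

lemma TwistingToDeg.right (h : TwistingToDeg 𝕜 A B 𝒜 ℬ τ n) : RightTwistingToDeg 𝒜 ℬ τ n := by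
  intro i j k hn b hb a ha a' ha'
  have := h.tmul_mul (i := 0) (by omega) (SetLike.one_mem_graded ℬ) hb ha ha'
  rw [one_mul] at this
  rw [this]
  refine eqOn_kunneth (fun p q hpq a ha c hc ↦ ?_) (h.1.tmul_mem rfl hb ha)
  rw [twistSandwich_tmul, h.2.1 p (by omega) a ha, rightAct_tmul, twistMul_tmul]
  congr 1
  refine eqOn_kunneth (g := LinearMap.id) (fun s t hst a ha c hc ↦ ?_)
    (h.1.tmul_mem (k := q + k) rfl hc ha')
  simp [h.2.1 s (by omega) a ha]

lemma twistingToDeg_of_left_of_right (hg : IsGradedMapBA 𝕜 A B 𝒜 ℬ τ)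
    (h₁ : ∀ a : A, τ ((1 : B) ⊗ₜ[𝕜] a) = a ⊗ₜ[𝕜] (1 : B))
    (h₂ : ∀ b : B, τ (b ⊗ₜ[𝕜] (1 : A)) = (1 : A) ⊗ₜ[𝕜] b)
    (hl : LeftTwistingToDeg 𝒜 ℬ τ n) (hr : RightTwistingToDeg 𝒜 ℬ τ n) :
    TwistingToDeg 𝕜 A B 𝒜 ℬ τ n := by
  refine ⟨hg, fun _ _ a _ ↦ h₁ a, fun _ _ b _ ↦ h₂ b, fun m hm x hx ↦ ?_⟩
  refine eqOn_kunneth (fun s t hst y hy z hz ↦ ?_) hx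
  refine eqOn_kunneth (f := twistLHS 𝕜 A B τ ∘ₗ (TensorProduct.mk 𝕜 _ _).flip z)
    (g := twistRHS 𝕜 A B τ ∘ₗ (TensorProduct.mk 𝕜 _ _).flip z) (fun i j hij b₁ hb₁ b₂ hb₂ ↦ ?_) hy
  refine eqOn_kunneth (f := twistLHS 𝕜 A B τ ∘ₗ TensorProduct.mk 𝕜 _ _ _)
    (g := twistRHS 𝕜 A B τ ∘ₗ TensorProduct.mk 𝕜 _ _ _) (fun k l hkl a₁ ha₁ a₂ ha₂ ↦ ?_) hz
  simp only [LinearMap.comp_apply, TensorProduct.mk_apply, twistRHS_tmul]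
  simp only [twistLHS, LinearMap.comp_apply, TensorProduct.map_tmul, LinearMap.mul'_apply]
  rw [hr (i + j) k l (by omega) _ (SetLike.mul_mem_graded hb₁ hb₂) _ ha₁ _ ha₂,
    hl i j k (by omega) _ hb₁ _ hb₂ _ ha₁]
  refine eqOn_kunneth (f := rightAct τ a₂ ∘ₗ leftAct τ b₁) (fun p q hpq a ha b hb ↦ ?_)
    (hg.tmul_mem rfl hb₂ ha₁)
  rw [twistSandwich_tmul, LinearMap.comp_apply, leftAct_tmul]
  refine eqOn_kunneth (f := rightAct τ a₂ ∘ₗ tensorMulRight b)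
    (g := (twistMul τ).flip (τ (b ⊗ₜ[𝕜] a₂))) (fun p' q' hpq' a' ha' b' hb' ↦ ?_)
    (hg.tmul_mem rfl hb₁ ha)
  simp [hl q' q l (by omega) _ hb' _ hb _ ha₂]

/-- A linear map that is multiplicative modulo a stable subspace `F` induces a representation on
the quotient by `F`. -/
def quotientRep {R V : Type} [Ring R] [Algebra 𝕜 R] [AddCommGroup V] [Module 𝕜 V]
    (ρ : R →ₗ[𝕜] V →ₗ[𝕜] V) (F : Submodule 𝕜 V) (hF : ∀ r, F ≤ F.comap (ρ r))
    (h₁ : ∀ v, ρ 1 v - v ∈ F) (hmul : ∀ r s v, ρ (r * s) v - ρ r (ρ s v) ∈ F) :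
    R →ₐ[𝕜] Module.End 𝕜 (V ⧸ F) :=
  AlgHom.ofLinearMap (Submodule.mapQLinear F F ∘ₗ LinearMap.codRestrict (F.compatibleMaps F) ρ hF)
    (Submodule.linearMap_qext _ <| LinearMap.ext fun v ↦ (Submodule.Quotient.eq F).2 (h₁ v))
    (fun r s ↦ Submodule.linearMap_qext _ <| LinearMap.ext fun v ↦
      (Submodule.Quotient.eq F).2 (hmul r s v))

/-- The representation of `A` on `A ⊗ B` truncated above degree `n`. -/
def leftRepA (𝒜 : ℕ → Submodule 𝕜 A) (ℬ : ℕ → Submodule 𝕜 B) [GradedAlgebra 𝒜] [GradedAlgebra ℬ]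
    (n : ℕ) : A →ₐ[𝕜] Module.End 𝕜 (A ⊗[𝕜] B ⧸ kunnethGT 𝒜 ℬ n) :=
  quotientRep tensorMulLeft _
    (fun a ↦ kunnethGT_le_comap fun m hm x hx ↦
      homogeneous_mem (𝒜 := 𝒜) (tensorMulLeft.flip x) _ (fun i a ha ↦
        mem_kunnethGT (by omega) (tensorMulLeft_mem_kunneth (k := i + m) rfl ha hx)) a)
    (fun x ↦ by simp [tensorMulLeft_one])
    (fun a a' x ↦ by simp [tensorMulLeft_mul])

lemma IsGradedMapBA.leftAct_kunnethGT_le (hτ : IsGradedMapBA 𝕜 A B 𝒜 ℬ τ) (n : ℕ) (b : B) :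
    kunnethGT 𝒜 ℬ n ≤ (kunnethGT 𝒜 ℬ n).comap (leftAct τ b) :=
  kunnethGT_le_comap fun m hm x hx ↦
    homogeneous_mem (𝒜 := ℬ) ((leftAct τ).flip x) _ (fun i b hb ↦
      mem_kunnethGT (by omega) (hτ.leftAct_mem (k := i + m) rfl hb hx)) b

lemma TwistingToDeg.leftAct_one_sub_mem (h : TwistingToDeg 𝕜 A B 𝒜 ℬ τ n) (x : A ⊗[𝕜] B) :
    leftAct τ 1 x - x ∈ kunnethGT 𝒜 ℬ n := by
  refine homogeneous_tmul_mem (𝒜 := 𝒜) (ℬ := ℬ) (leftAct τ 1 - LinearMap.id) _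
    (fun i j a ha b hb ↦ ?_) x
  by_cases hij : i ≤ n
  · simp [h.2.1 i hij a ha]
  · have hab : a ⊗ₜ[𝕜] b ∈ kunneth 𝕜 𝒜 ℬ (i + j) := tmul_mem_kunneth rfl ha hb
    exact mem_kunnethGT (m := i + j) (by omega) <| Submodule.sub_mem _
      (h.1.leftAct_mem (zero_add _) (SetLike.one_mem_graded ℬ) hab) hab

lemma TwistingToDeg.leftAct_mul_sub_mem (h : TwistingToDeg 𝕜 A B 𝒜 ℬ τ n) (b b' : B)
    (x : A ⊗[𝕜] B) : leftAct τ (b * b') x - leftAct τ b (leftAct τ b' x) ∈ kunnethGT 𝒜 ℬ n := by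
  refine homogeneous_mem (𝒜 := ℬ)
    ((leftAct τ).flip x ∘ₗ LinearMap.mulRight 𝕜 b' - (leftAct τ).flip (leftAct τ b' x)) _
    (fun i b hb ↦ ?_) b
  refine homogeneous_mem (𝒜 := ℬ)
    ((leftAct τ).flip x ∘ₗ LinearMap.mulLeft 𝕜 b - leftAct τ b ∘ₗ (leftAct τ).flip x) _
    (fun j b' hb' ↦ ?_) b'
  refine homogeneous_tmul_mem (𝒜 := 𝒜) (ℬ := ℬ)
    (leftAct τ (b * b') - leftAct τ b ∘ₗ leftAct τ b') _ (fun k l a ha c hc ↦ ?_) x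
  by_cases hn : i + j + k ≤ n
  · simp [h.left i j k hn b hb b' hb' a ha, leftAct_tensorMulRight]
  · have hac : a ⊗ₜ[𝕜] c ∈ kunneth 𝕜 𝒜 ℬ (k + l) := tmul_mem_kunneth rfl ha hc
    exact mem_kunnethGT (m := i + j + (k + l)) (by omega) <| Submodule.sub_mem _
      (h.1.leftAct_mem rfl (SetLike.mul_mem_graded hb hb') hac)
      (h.1.leftAct_mem (by omega) hb (h.1.leftAct_mem rfl hb' hac))

/-- The representation of `B` on `A ⊗ B` truncated above degree `n`, for a map `τ` that is twisting
to degree `n`. -/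
def TwistingToDeg.leftRepB (h : TwistingToDeg 𝕜 A B 𝒜 ℬ τ n) :
    B →ₐ[𝕜] Module.End 𝕜 (A ⊗[𝕜] B ⧸ kunnethGT 𝒜 ℬ n) :=
  quotientRep (leftAct τ) _ (h.1.leftAct_kunnethGT_le n) h.leftAct_one_sub_mem
    h.leftAct_mul_sub_mem

lemma TwistingToDeg.leftAct_tensorMulLeft_sub_mem (h : TwistingToDeg 𝕜 A B 𝒜 ℬ τ n) {i j : ℕ}
    {a : A} (ha : a ∈ 𝒜 i) {b : B} (hb : b ∈ ℬ j) (x : A ⊗[𝕜] B) :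
    leftAct τ b (tensorMulLeft a x) - twistMul τ (τ (b ⊗ₜ[𝕜] a)) x ∈ kunnethGT 𝒜 ℬ n := by
  refine homogeneous_tmul_mem (𝒜 := 𝒜) (ℬ := ℬ)
    (leftAct τ b ∘ₗ tensorMulLeft a - twistMul τ (τ (b ⊗ₜ[𝕜] a))) _ (fun k l a' ha' c hc ↦ ?_) x
  by_cases hn : j + i + k ≤ n
  · convert Submodule.zero_mem _
    rw [LinearMap.sub_apply, sub_eq_zero, LinearMap.comp_apply, tensorMulLeft_tmul, leftAct_tmul,
      h.right j i k hn b hb a ha a' ha']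
    refine eqOn_kunneth (f := tensorMulRight c ∘ₗ rightAct τ a')
      (g := (twistMul τ).flip (a' ⊗ₜ[𝕜] c)) (fun p q hpq s hs t ht ↦ ?_) (h.1.tmul_mem rfl hb ha)
    simp [tensorMulLeft_tensorMulRight]
  · have hac : a' ⊗ₜ[𝕜] c ∈ kunneth 𝕜 𝒜 ℬ (k + l) := tmul_mem_kunneth rfl ha' hc
    exact mem_kunnethGT (m := j + i + (k + l)) (by omega) <| Submodule.sub_mem _
      (h.1.leftAct_mem (by omega) hb (tensorMulLeft_mem_kunneth rfl ha hac))
      (h.1.twistMul_mem rfl (h.1.tmul_mem rfl hb ha) hac)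

section FreeProduct

variable {P : Type} [Ring P] [Algebra 𝕜 P] {ιA : A →ₐ[𝕜] P} {ιB : B →ₐ[𝕜] P}

@[simp]
lemma mulMapP_tmul (a : A) (b : B) : mulMapP 𝕜 A B P ιA ιB (a ⊗ₜ[𝕜] b) = ιA a * ιB b := rfl

lemma idealSpan_mul_left {s : Set P} (c : P) {x : P} (hx : x ∈ idealSpan 𝕜 P s) :
    c * x ∈ idealSpan 𝕜 P s := by
  refine Submodule.span_le (p := (idealSpan 𝕜 P s).comap (LinearMap.mulLeft 𝕜 c)) |>.2 ?_ hx
  rintro _ ⟨d, e, r, hr, rfl⟩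
  exact Submodule.subset_span ⟨c * d, e, r, hr, by simp [mul_assoc]⟩

lemma idealSpan_mul_right {s : Set P} (c : P) {x : P} (hx : x ∈ idealSpan 𝕜 P s) :
    x * c ∈ idealSpan 𝕜 P s := by
  refine Submodule.span_le (p := (idealSpan 𝕜 P s).comap (LinearMap.mulRight 𝕜 c)) |>.2 ?_ hx
  rintro _ ⟨d, e, r, hr, rfl⟩
  exact Submodule.subset_span ⟨d, e * c, r, hr, by simp [mul_assoc]⟩

lemma subset_idealSpan {s : Set P} : s ⊆ idealSpan 𝕜 P s :=
  fun x hx ↦ Submodule.subset_span ⟨1, 1, x, hx, by simp⟩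

lemma idealSpan_le {s : Set P} {S : Submodule 𝕜 P} (h : ∀ c d, ∀ r ∈ s, c * r * d ∈ S) :
    idealSpan 𝕜 P s ≤ S :=
  Submodule.span_le.2 <| by rintro _ ⟨c, d, r, hr, rfl⟩; exact h c d r hr

/-- The linear map sending `b ⊗ a` to the `τ`-relation `b ⊗ a - τ(b ⊗ a)` of the free product. -/
def relMap (ιA : A →ₐ[𝕜] P) (ιB : B →ₐ[𝕜] P) (τ : B ⊗[𝕜] A →ₗ[𝕜] A ⊗[𝕜] B) :
    B ⊗[𝕜] A →ₗ[𝕜] P :=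
  mulMapP 𝕜 B A P ιB ιA - mulMapP 𝕜 A B P ιA ιB ∘ₗ τ

lemma relMap_tmul (b : B) (a : A) : relMap ιA ιB τ (b ⊗ₜ[𝕜] a) =
    ιB b * ιA a - mulMapP 𝕜 A B P ιA ιB (τ (b ⊗ₜ[𝕜] a)) := rfl

lemma idealSpan_relSetAll_eq_iff {m : ℕ} :
    idealSpan 𝕜 P (relSetAll 𝕜 A B P ιA ιB τ) = idealSpan 𝕜 P (relSetLe 𝕜 A B P ιA ιB 𝒜 ℬ τ m) ↔
      ∀ i j, ∀ b ∈ ℬ i, ∀ a ∈ 𝒜 j, relMap ιA ιB τ (b ⊗ₜ[𝕜] a) ∈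
        idealSpan 𝕜 P (relSetLe 𝕜 A B P ιA ιB 𝒜 ℬ τ m) := by
  constructor
  · intro h i j b _ a _
    rw [← h]
    exact subset_idealSpan ⟨a, b, rfl⟩
  · intro h
    refine le_antisymm (idealSpan_le ?_) (idealSpan_le ?_)
    · rintro c d _ ⟨a, b, rfl⟩
      exact idealSpan_mul_right _ <| idealSpan_mul_left _ <|
        homogeneous_tmul_mem (𝒜 := ℬ) (ℬ := 𝒜) (relMap ιA ιB τ) _ h (b ⊗ₜ[𝕜] a)
    · rintro c d _ ⟨_, _, a, b, _, _, _, rfl⟩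
      exact Submodule.subset_span ⟨c, d, _, ⟨a, b, rfl⟩, rfl⟩

theorem uep_of_idealSpan_eq (hP : IsFreeProduct 𝕜 A B P ιA ιB)
    (hτ : IsGradedMapBA 𝕜 A B 𝒜 ℬ τ)
    (h : idealSpan 𝕜 P (relSetAll 𝕜 A B P ιA ιB τ) =
      idealSpan 𝕜 P (relSetLe 𝕜 A B P ιA ιB 𝒜 ℬ τ 2)) :
    UEP 𝕜 A B 𝒜 ℬ τ := by
  intro n hn τ' hτ' heq x hx
  obtain ⟨ρ, ⟨hρA, hρB⟩, -⟩ := hP _ (leftRepA 𝒜 ℬ n) hτ'.leftRepB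
  have hA (a : A) (x : A ⊗[𝕜] B) : ρ (ιA a) ((kunnethGT 𝒜 ℬ n).mkQ x) =
      (kunnethGT 𝒜 ℬ n).mkQ (tensorMulLeft a x) := by
    rw [← AlgHom.comp_apply, hρA]; rfl
  have hB (b : B) (x : A ⊗[𝕜] B) : ρ (ιB b) ((kunnethGT 𝒜 ℬ n).mkQ x) =
      (kunnethGT 𝒜 ℬ n).mkQ (leftAct τ' b x) := by
    rw [← AlgHom.comp_apply, hρB]; rfl
  have hAB (y x : A ⊗[𝕜] B) : ρ (mulMapP 𝕜 A B P ιA ιB y) ((kunnethGT 𝒜 ℬ n).mkQ x) =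
      (kunnethGT 𝒜 ℬ n).mkQ (twistMul τ' y x) := by
    induction y using TensorProduct.induction_on with
    | zero => simp
    | add y y' hy hy' => simp only [map_add, LinearMap.add_apply, hy, hy']
    | tmul a b => rw [mulMapP_tmul, map_mul, Module.End.mul_apply, hB, hA, twistMul_tmul]
  have hker : idealSpan 𝕜 P (relSetAll 𝕜 A B P ιA ιB τ) ≤ LinearMap.ker ρ.toLinearMap := by
    rw [h]
    refine idealSpan_le ?_
    rintro c d _ ⟨i, j, a, b, hij, ha, hb, rfl⟩
    suffices hzero : ρ (ιB b * ιA a - mulMapP 𝕜 A B P ιA ιB (τ (b ⊗ₜ[𝕜] a))) = 0 by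
      rw [LinearMap.mem_ker, AlgHom.toLinearMap_apply, map_mul, map_mul, hzero, mul_zero, zero_mul]
    refine Submodule.linearMap_qext _ <| LinearMap.ext fun x ↦ ?_
    rw [LinearMap.comp_apply, map_sub, map_mul, LinearMap.sub_apply, Module.End.mul_apply, hA, hB,
      hAB, ← heq (j + i) (by omega) _ (tmul_mem_kunneth rfl hb ha), ← map_sub]
    exact (Submodule.Quotient.mk_eq_zero _).2 (hτ'.leftAct_tensorMulLeft_sub_mem ha hb x)
  refine eqOn_kunneth (fun i j hij b hb a ha ↦ ?_) hx
  have hmem : ιB b * ιA a - mulMapP 𝕜 A B P ιA ιB (τ (b ⊗ₜ[𝕜] a)) ∈ LinearMap.ker ρ.toLinearMap :=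
    hker (subset_idealSpan ⟨a, b, rfl⟩)
  have := LinearMap.congr_fun hmem ((kunnethGT 𝒜 ℬ n).mkQ (1 ⊗ₜ[𝕜] 1))
  rw [AlgHom.toLinearMap_apply, map_sub, map_mul, LinearMap.sub_apply, Module.End.mul_apply, hA, hB,
    hAB, ← map_sub, hτ'.twistMul_one_tmul (m := n) le_rfl (hτ.tmul_mem hij hb ha)] at this
  rw [← sub_eq_zero]
  refine eq_zero_of_mem_kunnethGT (𝒜 := 𝒜) (ℬ := ℬ) (Submodule.sub_mem _ (hτ'.1.tmul_mem hij hb ha)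
    (hτ.tmul_mem hij hb ha)) ?_
  exact (Submodule.Quotient.mk_eq_zero _).1 (by simpa [tensorMulRight_one] using this)

lemma IsGradedTwisting.twistingToDeg (hτ : IsGradedTwisting 𝕜 A B 𝒜 ℬ τ) (n : ℕ) :
    TwistingToDeg 𝕜 A B 𝒜 ℬ τ n :=
  ⟨hτ.2, fun _ _ a _ ↦ hτ.1.1 a, fun _ _ b _ ↦ hτ.1.2.1 b, fun _ _ x _ ↦
    LinearMap.congr_fun hτ.1.2.2 x⟩

lemma mul_mulMapP (a : A) (x : A ⊗[𝕜] B) :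
    ιA a * mulMapP 𝕜 A B P ιA ιB x = mulMapP 𝕜 A B P ιA ιB (tensorMulLeft a x) := by
  induction x using TensorProduct.induction_on with
  | zero => simp
  | add x y hx hy => simp [mul_add, hx, hy]
  | tmul a b => simp [mul_assoc]

lemma mulMapP_mul (b : B) (x : A ⊗[𝕜] B) :
    mulMapP 𝕜 A B P ιA ιB x * ιB b = mulMapP 𝕜 A B P ιA ιB (tensorMulRight b x) := by
  induction x using TensorProduct.induction_on with
  | zero => simp
  | add x y hx hy => simp [add_mul, hx, hy]
  | tmul a b => simp [mul_assoc]

/-- The failure of `mulMapP` to intertwine `leftAct τ b` with left multiplication by `b`. -/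
def leftDefect (ιA : A →ₐ[𝕜] P) (ιB : B →ₐ[𝕜] P) (τ : B ⊗[𝕜] A →ₗ[𝕜] A ⊗[𝕜] B) (b : B) :
    A ⊗[𝕜] B →ₗ[𝕜] P :=
  LinearMap.mulLeft 𝕜 (ιB b) ∘ₗ mulMapP 𝕜 A B P ιA ιB - mulMapP 𝕜 A B P ιA ιB ∘ₗ leftAct τ b

/-- The failure of `mulMapP` to intertwine `rightAct τ a` with right multiplication by `a`. -/
def rightDefect (ιA : A →ₐ[𝕜] P) (ιB : B →ₐ[𝕜] P) (τ : B ⊗[𝕜] A →ₗ[𝕜] A ⊗[𝕜] B) (a : A) :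
    A ⊗[𝕜] B →ₗ[𝕜] P :=
  LinearMap.mulRight 𝕜 (ιA a) ∘ₗ mulMapP 𝕜 A B P ιA ιB - mulMapP 𝕜 A B P ιA ιB ∘ₗ rightAct τ a

lemma leftDefect_tmul (b b' : B) (a : A) :
    leftDefect ιA ιB τ b (a ⊗ₜ[𝕜] b') = relMap ιA ιB τ (b ⊗ₜ[𝕜] a) * ιB b' := by
  simp [leftDefect, relMap_tmul, sub_mul, mulMapP_mul, mul_assoc]

lemma rightDefect_tmul (a a' : A) (b : B) :
    rightDefect ιA ιB τ a (a' ⊗ₜ[𝕜] b) = ιA a' * relMap ιA ιB τ (b ⊗ₜ[𝕜] a) := by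
  simp [rightDefect, relMap_tmul, mul_sub, mul_mulMapP, mul_assoc]

lemma relMap_mul_tmul {b b' : B} {a : A}
    (h : τ ((b * b') ⊗ₜ[𝕜] a) = leftAct τ b (τ (b' ⊗ₜ[𝕜] a))) :
    relMap ιA ιB τ ((b * b') ⊗ₜ[𝕜] a) =
      ιB b * relMap ιA ιB τ (b' ⊗ₜ[𝕜] a) + leftDefect ιA ιB τ b (τ (b' ⊗ₜ[𝕜] a)) := by
  simp [leftDefect, relMap_tmul, h, mul_sub, mul_assoc]

lemma relMap_tmul_mul {b : B} {a a' : A}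
    (h : τ (b ⊗ₜ[𝕜] (a * a')) = rightAct τ a' (τ (b ⊗ₜ[𝕜] a))) :
    relMap ιA ιB τ (b ⊗ₜ[𝕜] (a * a')) =
      relMap ιA ιB τ (b ⊗ₜ[𝕜] a) * ιA a' + rightDefect ιA ιB τ a' (τ (b ⊗ₜ[𝕜] a)) := by
  simp [rightDefect, relMap_tmul, h, sub_mul, mul_assoc]

lemma leftAct_add (σ : B ⊗[𝕜] A →ₗ[𝕜] A ⊗[𝕜] B) (b : B) (x : A ⊗[𝕜] B) :
    leftAct (τ + σ) b x = leftAct τ b x + leftAct σ b x := by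
  induction x using TensorProduct.induction_on with
  | zero => simp
  | add x y hx hy => simp only [map_add, hx, hy]; abel
  | tmul a b => simp

lemma rightAct_add (σ : B ⊗[𝕜] A →ₗ[𝕜] A ⊗[𝕜] B) (a : A) (x : A ⊗[𝕜] B) :
    rightAct (τ + σ) a x = rightAct τ a x + rightAct σ a x := by
  induction x using TensorProduct.induction_on with
  | zero => simp
  | add x y hx hy => simp only [map_add, hx, hy]; abel
  | tmul a b => simp

theorem relMap_mem_of_uep (hconnA : 𝒜 0 = (1 : Submodule 𝕜 A)) (hconnB : ℬ 0 = (1 : Submodule 𝕜 B))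
    (hτ : IsGradedTwisting 𝕜 A B 𝒜 ℬ τ) (h : UEP 𝕜 A B 𝒜 ℬ τ) (n : ℕ) :
    ∀ x ∈ kunneth 𝕜 ℬ 𝒜 n,
      relMap ιA ιB τ x ∈ idealSpan 𝕜 P (relSetLe 𝕜 A B P ιA ιB 𝒜 ℬ τ 2) := by
  set I := idealSpan 𝕜 P (relSetLe 𝕜 A B P ιA ιB 𝒜 ℬ τ 2)
  induction n using Nat.strong_induction_on with
  | _ n ih =>
  by_cases hn : n ≤ 2
  · exact fun x ↦ map_mem_of_mem_kunneth _ _ fun i j hij b hb a ha ↦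
      (subset_idealSpan ⟨j, i, a, b, by omega, ha, hb, rfl⟩ : relMap ιA ιB τ (b ⊗ₜ[𝕜] a) ∈ I)
  by_contra! hcon
  obtain ⟨x₀, hx₀, hx₀I⟩ := hcon
  obtain ⟨f, hf, hfI⟩ := Submodule.exists_le_ker_of_notMem hx₀I
  replace hfI (z : P) (hz : z ∈ I) : f z = 0 := hfI hz
  set u : A ⊗[𝕜] B := TensorProduct.comm 𝕜 B A x₀ with hu
  have hun : u ∈ kunneth 𝕜 𝒜 ℬ n :=
    map_mem_of_mem_kunneth (TensorProduct.comm 𝕜 B A).toLinearMap _ (fun i j hij b hb a ha ↦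
      tmul_mem_kunneth (by omega) ha hb) hx₀
  let δ : B ⊗[𝕜] A →ₗ[𝕜] A ⊗[𝕜] B :=
    (LinearMap.toSpanSingleton 𝕜 _ u ∘ₗ f ∘ₗ relMap ιA ιB τ) ∘ₗ kunnethProj ℬ 𝒜 n
  have hδ_apply {m : ℕ} {y : B ⊗[𝕜] A} (hy : y ∈ kunneth 𝕜 ℬ 𝒜 m) :
      δ y = if m = n then f (relMap ιA ιB τ y) • u else 0 := by
    simp only [δ, LinearMap.comp_apply, kunnethProj_of_mem hy]
    split_ifs <;> simp
  have hδ_le {m : ℕ} (hm : m ≤ n) {y : B ⊗[𝕜] A} (hy : y ∈ kunneth 𝕜 ℬ 𝒜 m) :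
      δ y = f (relMap ιA ιB τ y) • u := by
    rw [hδ_apply hy]
    split_ifs with hmn
    · rfl
    · rw [hfI _ (ih m (by omega) y hy), zero_smul]
  have hδ_lt {m : ℕ} (hm : m < n) {y : B ⊗[𝕜] A} (hy : y ∈ kunneth 𝕜 ℬ 𝒜 m) : δ y = 0 := by
    rw [hδ_apply hy, if_neg hm.ne]
  have hδ_one (a : A) : δ (1 ⊗ₜ[𝕜] a) = 0 := by
    refine LinearMap.congr_fun (homogeneous_ext (𝒜 := 𝒜) (f := δ ∘ₗ TensorProduct.mk 𝕜 B A 1) (g := 0)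
      fun i a ha ↦ ?_) a
    have : relMap ιA ιB τ (1 ⊗ₜ[𝕜] a) = 0 := by simp [relMap_tmul, hτ.1.1]
    simp [hδ_apply (tmul_mem_kunneth (zero_add i) (SetLike.one_mem_graded ℬ) ha), this]
  have hδ_one' (b : B) : δ (b ⊗ₜ[𝕜] 1) = 0 := by
    refine LinearMap.congr_fun (homogeneous_ext (𝒜 := ℬ) (f := δ ∘ₗ (TensorProduct.mk 𝕜 B A).flip 1)
      (g := 0) fun i b hb ↦ ?_) b
    have : relMap ιA ιB τ (b ⊗ₜ[𝕜] 1) = 0 := by simp [relMap_tmul, hτ.1.2.1]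
    simp [hδ_apply (tmul_mem_kunneth (add_zero i) hb (SetLike.one_mem_graded 𝒜)), this]
  have hδ_left {i m : ℕ} (him : i + m ≤ n) {b : B} (hb : b ∈ ℬ i) {x : A ⊗[𝕜] B}
      (hx : x ∈ kunneth 𝕜 𝒜 ℬ m) : leftAct δ b x = f (leftDefect ιA ιB τ b x) • u := by
    refine eqOn_kunneth (g := LinearMap.toSpanSingleton 𝕜 _ u ∘ₗ f ∘ₗ leftDefect ιA ιB τ b)
      (fun s t hst a ha c hc ↦ ?_) hx
    simp only [LinearMap.comp_apply, leftDefect_tmul, leftAct_tmul,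
      LinearMap.toSpanSingleton_apply]
    rcases Nat.eq_zero_or_pos t with rfl | ht
    · rw [hconnB] at hc
      obtain ⟨r, rfl⟩ := Submodule.mem_one.1 hc
      rw [hδ_le (m := i + s) (by omega) (tmul_mem_kunneth rfl hb ha)]
      simp [Algebra.algebraMap_eq_smul_one, tensorMulRight_one, smul_smul, mul_comm]
    · rw [hδ_lt (m := i + s) (by omega) (tmul_mem_kunneth rfl hb ha),
        hfI _ (idealSpan_mul_right _ (ih (i + s) (by omega) _ (tmul_mem_kunneth rfl hb ha)))]
      simp
  have hδ_right {i m : ℕ} (him : m + i ≤ n) {a : A} (ha : a ∈ 𝒜 i) {x : A ⊗[𝕜] B}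
      (hx : x ∈ kunneth 𝕜 𝒜 ℬ m) : rightAct δ a x = f (rightDefect ιA ιB τ a x) • u := by
    refine eqOn_kunneth (g := LinearMap.toSpanSingleton 𝕜 _ u ∘ₗ f ∘ₗ rightDefect ιA ιB τ a)
      (fun s t hst c hc b hb ↦ ?_) hx
    simp only [LinearMap.comp_apply, rightDefect_tmul, rightAct_tmul,
      LinearMap.toSpanSingleton_apply]
    rcases Nat.eq_zero_or_pos s with rfl | hs
    · rw [hconnA] at hc
      obtain ⟨r, rfl⟩ := Submodule.mem_one.1 hc
      rw [hδ_le (m := t + i) (by omega) (tmul_mem_kunneth rfl hb ha)]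
      simp [Algebra.algebraMap_eq_smul_one, tensorMulLeft_one, smul_smul, mul_comm]
    · rw [hδ_lt (m := t + i) (by omega) (tmul_mem_kunneth rfl hb ha),
        hfI _ (idealSpan_mul_left _ (ih (t + i) (by omega) _ (tmul_mem_kunneth rfl hb ha)))]
      simp
  have hτn := hτ.twistingToDeg n
  have hg : IsGradedMapBA 𝕜 A B 𝒜 ℬ (τ + δ) := by
    rintro m _ ⟨y, hy, rfl⟩
    refine Submodule.add_mem _ (hτ.2 m ⟨y, hy, rfl⟩) ?_
    rw [hδ_apply hy]
    split_ifs with hmn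
    · exact hmn ▸ Submodule.smul_mem _ _ hun
    · exact Submodule.zero_mem _
  have h₁ (a : A) : (τ + δ) (1 ⊗ₜ[𝕜] a) = a ⊗ₜ[𝕜] 1 := by simp [hδ_one, hτ.1.1]
  have h₂ (b : B) : (τ + δ) (b ⊗ₜ[𝕜] 1) = 1 ⊗ₜ[𝕜] b := by simp [hδ_one', hτ.1.2.1]
  have hl : LeftTwistingToDeg 𝒜 ℬ (τ + δ) n := by
    intro i j k hijk b hb b' hb' a ha
    rcases Nat.eq_zero_or_pos i with rfl | hi
    · rw [hconnB] at hb
      obtain ⟨r, rfl⟩ := Submodule.mem_one.1 hb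
      have hid : leftAct (τ + δ) 1 = LinearMap.id :=
        TensorProduct.ext' fun a b ↦ by rw [leftAct_tmul, h₁]; simp
      simp [Algebra.algebraMap_eq_smul_one, hid, ← TensorProduct.smul_tmul']
    · have hb'a := tmul_mem_kunneth (𝕜 := 𝕜) (rfl : j + k = _) hb' ha
      have hτl := hτn.left i j k hijk b hb b' hb' a ha
      rw [LinearMap.add_apply, LinearMap.add_apply, hδ_lt (by omega) hb'a, add_zero, leftAct_add,
        hτl, hδ_le hijk (tmul_mem_kunneth rfl (SetLike.mul_mem_graded hb hb') ha),
        hδ_left (by omega) hb (hτ.2.tmul_mem rfl hb' ha), relMap_mul_tmul hτl, map_add,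
        hfI _ (idealSpan_mul_left _ (ih (j + k) (by omega) _ hb'a)), zero_add]
  have hr : RightTwistingToDeg 𝒜 ℬ (τ + δ) n := by
    intro i j k hijk b hb a ha a' ha'
    rcases Nat.eq_zero_or_pos k with rfl | hk
    · rw [hconnA] at ha'
      obtain ⟨r, rfl⟩ := Submodule.mem_one.1 ha'
      have hid : rightAct (τ + δ) 1 = LinearMap.id :=
        TensorProduct.ext' fun a b ↦ by rw [rightAct_tmul, h₂]; simp
      simp [Algebra.algebraMap_eq_smul_one, hid]
    · have hba := tmul_mem_kunneth (𝕜 := 𝕜) (rfl : i + j = _) hb ha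
      have hτr := hτn.right i j k hijk b hb a ha a' ha'
      rw [LinearMap.add_apply, LinearMap.add_apply, hδ_lt (by omega) hba, add_zero, rightAct_add,
        hτr, hδ_le (m := i + (j + k)) (by omega)
          (tmul_mem_kunneth rfl hb (SetLike.mul_mem_graded ha ha')),
        hδ_right (by omega) ha' (hτ.2.tmul_mem rfl hb ha), relMap_tmul_mul hτr, map_add,
        hfI _ (idealSpan_mul_right _ (ih (i + j) (by omega) _ hba)), zero_add]
  have hδx₀ := h n (by omega) (τ + δ) (twistingToDeg_of_left_of_right hg h₁ h₂ hl hr)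
    (fun i hi x hx ↦ by simp [hδ_lt hi hx]) x₀ hx₀
  rw [LinearMap.add_apply, add_eq_left, hδ_le le_rfl hx₀, smul_eq_zero, or_iff_right hf, hu,
    LinearEquiv.map_eq_zero_iff] at hδx₀
  exact hx₀I (by simp [hδx₀])

end FreeProduct

end Graded

end Twisting

/-- Theorem 4.3 (`UEPquadratic`).  Let `A`, `B` be connected graded algebras, `τ` a
graded twisting map, and `(P, ιA, ιB)` a free product of `A` and `B`.  Then `τ` has the
unique extension property iff `A ⊗_τ B` is `τ`-quadratic, i.e. the ideal `I_τ ⊆ A * B`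
generated by all `τ`-relations `b ⊗ a - τ(b ⊗ a)` is generated by the `τ`-relations of
degree at most `2`. -/
theorem stmt6 (𝕜 : Type) [Field 𝕜] (A B : Type) [Ring A] [Algebra 𝕜 A] [Ring B] [Algebra 𝕜 B]
    (𝒜 : ℕ → Submodule 𝕜 A) (ℬ : ℕ → Submodule 𝕜 B)
    [GradedAlgebra 𝒜] [GradedAlgebra ℬ]
    (hconnA : 𝒜 0 = (1 : Submodule 𝕜 A)) (hconnB : ℬ 0 = (1 : Submodule 𝕜 B))
    (τ : B ⊗[𝕜] A →ₗ[𝕜] A ⊗[𝕜] B)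
    (hτ : IsGradedTwisting 𝕜 A B 𝒜 ℬ τ)
    (P : Type) [Ring P] [Algebra 𝕜 P] (ιA : A →ₐ[𝕜] P) (ιB : B →ₐ[𝕜] P)
    (hP : IsFreeProduct 𝕜 A B P ιA ιB) :
    UEP 𝕜 A B 𝒜 ℬ τ ↔
      idealSpan 𝕜 P (relSetAll 𝕜 A B P ιA ιB τ) =
        idealSpan 𝕜 P (relSetLe 𝕜 A B P ιA ιB 𝒜 ℬ τ 2) := by
  exact ⟨fun h ↦ idealSpan_relSetAll_eq_iff.2 fun i j b hb a ha ↦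
    relMap_mem_of_uep hconnA hconnB hτ h (i + j) _ (tmul_mem_kunneth rfl hb ha),
    uep_of_idealSpan_eq hP hτ.2⟩

end TTP
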